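/- Let T be an ℝ-tree and let G be a group with a non-nesting action on T by weak homeomorphisms. If g, h ∈ G are elliptic and their fixed-point sets satisfy T^g ∩ T^h = ∅, then gh is loxodromic, the axis L_{gh} contains the bridge between T^g and T^h, and each of the intersections T^g ∩ L_{gh} and T^h ∩ L_{gh} consists of exactly one point. -/

import Mathlib

open Set

/-- A topologically embedded arc in `T` joining `x` to `y`, given as a subset:
the image of a continuous injective map on `[0,1]` with endpoints `x` and `y`
(such a map is automatically a topological embedding). -/
def IsArc {T : Type*} [MetricSpace T] (A : Set T) (x y : T) : Prop :=
  ∃ f : ℝ → T, ContinuousOn f (Icc (0 : ℝ) 1) ∧ InjOn f (Icc (0 : ℝ) 1) ∧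
    f '' Icc (0 : ℝ) 1 = A ∧ f 0 = x ∧ f 1 = y

/-- `A ⊆ T` is isometric to a closed bounded interval of `ℝ`. -/
def IsIsometricToInterval {T : Type*} [MetricSpace T] (A : Set T) : Prop :=
  ∃ (a b : ℝ) (f : ℝ → T), a ≤ b ∧
    (∀ s ∈ Icc a b, ∀ t ∈ Icc a b, dist (f s) (f t) = |s - t|) ∧
    f '' Icc a b = A

/-- An `ℝ`-tree: a metric space in which any two distinct points are joined by a
unique topologically embedded arc, and this arc is isometric to a closed bounded
interval of `ℝ`. -/
structure IsRTree (T : Type*) [MetricSpace T] : Prop where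
  arc_existsUnique : ∀ ⦃x y : T⦄, x ≠ y → ∃! A : Set T, IsArc A x y
  arc_isometric : ∀ ⦃x y : T⦄, x ≠ y → ∀ A : Set T, IsArc A x y → IsIsometricToInterval A

open scoped Classical in
/-- The segment `[x,y]`: the unique arc joining `x` to `y` if `x ≠ y`
(computed as the intersection of all such arcs), and `{x}` if `x = y`. -/
noncomputable def seg {T : Type*} [MetricSpace T] (x y : T) : Set T :=
  if x = y then {x} else ⋂₀ {A : Set T | IsArc A x y}

/-- Betweenness: `Btwn x y z` iff `x ∈ [y,z] \ {y,z}`. -/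
def Btwn {T : Type*} [MetricSpace T] (x y z : T) : Prop :=
  x ∈ seg y z ∧ x ≠ y ∧ x ≠ z

/-- A weak homeomorphism of `T`: a bijection preserving the betweenness relation. -/
def IsWeakHomeo {T : Type*} [MetricSpace T] (g : T → T) : Prop :=
  Function.Bijective g ∧ ∀ x y z : T, Btwn x y z ↔ Btwn (g x) (g y) (g z)

/-- Convex subsets (subtrees) of `T`. -/
def ConvexSubtree {T : Type*} [MetricSpace T] (S : Set T) : Prop :=
  ∀ x ∈ S, ∀ y ∈ S, seg x y ⊆ S

/-- The action of `G` on `T` is by weak homeomorphisms. -/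
def ActsByWeakHomeos (G T : Type*) [Group G] [MulAction G T] [MetricSpace T] : Prop :=
  ∀ g : G, IsWeakHomeo (fun t : T => g • t)

/-- The action of `G` on `T` is non-nesting: no segment is mapped properly into itself. -/
def NonNesting (G T : Type*) [Group G] [MulAction G T] [MetricSpace T] : Prop :=
  ∀ (g : G) (x y : T), ¬ ((fun t : T => g • t) '' seg x y ⊂ seg x y)

/-- The fixed-point set `T^g` of a group element. -/
def fixedSet (T : Type*) {G : Type*} [Group G] [MulAction G T] (g : G) : Set T :=
  {t : T | g • t = t}

/-- `x, y, z` span a tripod: the median of `x, y, z` lies in none of `{x,y,z}`. -/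
def IsTripod {T : Type*} [MetricSpace T] (x y z : T) : Prop :=
  ∀ c ∈ seg x y ∩ seg y z ∩ seg z x, c ≠ x ∧ c ≠ y ∧ c ≠ z

/-- `S` contains no tripod. -/
def NoTripod {T : Type*} [MetricSpace T] (S : Set T) : Prop :=
  ¬ ∃ x y z : T, IsTripod x y z ∧ seg x y ∪ seg y z ∪ seg z x ⊆ S

/-- A line: a convex subset containing no tripod, maximal for inclusion. -/
def IsLine {T : Type*} [MetricSpace T] (L : Set T) : Prop :=
  ConvexSubtree L ∧ NoTripod L ∧
    ∀ L' : Set T, ConvexSubtree L' → NoTripod L' → L ⊆ L' → L' = L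

/-- `L` is an axis for `g`: a `g`-invariant line. -/
def IsAxis {G T : Type*} [Group G] [MulAction G T] [MetricSpace T] (g : G) (L : Set T) :
    Prop :=
  IsLine L ∧ (fun t : T => g • t) '' L = L



/-- `z` lies between `x` and `y`, metrically. -/
def MidP {T : Type*} [MetricSpace T] (x z y : T) : Prop :=
  dist x z + dist z y = dist x y

section Tree
variable {T : Type*} [MetricSpace T]

lemma isArc_of_Icc {α β : ℝ} (hαβ : α < β) (f : ℝ → T) (hc : ContinuousOn f (Icc α β))
    (hi : InjOn f (Icc α β)) : IsArc (f '' Icc α β) (f α) (f β) := by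
  have hpos : 0 < β - α := by linarith
  have himg : (fun t : ℝ => α + (β - α) * t) '' Icc (0:ℝ) 1 = Icc α β := by
    ext u
    constructor
    · rintro ⟨t, ⟨h0, h1⟩, rfl⟩
      constructor <;> dsimp only <;> nlinarith
    · rintro ⟨h0, h1⟩
      refine ⟨(u - α) / (β - α), ⟨by apply div_nonneg <;> linarith, ?_⟩, ?_⟩
      · rw [div_le_one hpos]; linarith
      · dsimp only; field_simp; ring
  have hmaps : MapsTo (fun t : ℝ => α + (β - α) * t) (Icc (0:ℝ) 1) (Icc α β) := by
    rw [← himg]; exact mapsTo_image _ _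
  refine ⟨fun t => f (α + (β - α) * t), ?_, ?_, ?_, ?_, ?_⟩
  · exact hc.comp (by fun_prop) hmaps
  · intro s hs t ht hst
    have := hi (hmaps hs) (hmaps ht) hst
    dsimp only at this
    have h2 : (β - α) * s = (β - α) * t := by linarith
    exact mul_left_cancel₀ hpos.ne' h2
  · rw [← himg, image_image]
  · simp
  · simp

lemma seg_eq_of_arc (hT : IsRTree T) {x y : T} (hxy : x ≠ y) {A : Set T} (hA : IsArc A x y) :
    seg x y = A := by
  obtain ⟨B, hB, hu⟩ := hT.arc_existsUnique hxy
  unfold seg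
  rw [if_neg hxy]
  apply Subset.antisymm
  · exact sInter_subset_of_mem hA
  · intro z hz C hC
    rw [hu C hC, ← hu A hA]; exact hz

lemma geod_cont {φ : ℝ → T} {d : ℝ}
    (hφ : ∀ s ∈ Icc 0 d, ∀ t ∈ Icc 0 d, dist (φ s) (φ t) = |s - t|) :
    ContinuousOn φ (Icc 0 d) ∧ InjOn φ (Icc 0 d) := by
  constructor
  · apply LipschitzOnWith.continuousOn (K := 1)
    apply LipschitzOnWith.of_dist_le_mul
    intro s hs t ht
    rw [hφ s hs t ht, Real.dist_eq]; simp
  · intro s hs t ht hst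
    have := hφ s hs t ht
    rw [hst, dist_self] at this
    exact sub_eq_zero.1 (abs_eq_zero.1 this.symm)

lemma exists_geod (hT : IsRTree T) (x y : T) : ∃ φ : ℝ → T, φ 0 = x ∧ φ (dist x y) = y ∧
    (∀ s ∈ Icc 0 (dist x y), ∀ t ∈ Icc 0 (dist x y), dist (φ s) (φ t) = |s - t|) ∧
    seg x y = φ '' Icc 0 (dist x y) := by
  by_cases hxy : x = y
  · subst hxy
    refine ⟨fun _ => x, rfl, rfl, ?_, ?_⟩
    · intro s hs t ht
      simp only [dist_self, Icc_self, mem_singleton_iff] at hs ht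
      simp [hs, ht]
    · simp [seg]
  obtain ⟨A, hA, -⟩ := hT.arc_existsUnique hxy
  obtain ⟨α, β, f, hαβ, hf, himg⟩ := hT.arc_isometric hxy A hA
  have hxA : x ∈ A := by
    obtain ⟨k, -, -, h3, h4, -⟩ := hA
    rw [← h3, ← h4]; exact mem_image_of_mem _ (by simp)
  have hyA : y ∈ A := by
    obtain ⟨k, -, -, h3, -, h4⟩ := hA
    rw [← h3, ← h4]; exact mem_image_of_mem _ (by simp)
  rw [← himg] at hxA hyA
  obtain ⟨s, hs, hsx⟩ := hxA
  obtain ⟨t, ht, hty⟩ := hyA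
  have hd : dist x y = |s - t| := by rw [← hsx, ← hty]; exact hf s hs t ht
  have hdpos : 0 < dist x y := dist_pos.2 hxy
  obtain ⟨ε, hε, hεt⟩ : ∃ ε : ℝ, |ε| = 1 ∧ s + ε * dist x y = t := by
    rcases le_total s t with h | h
    · refine ⟨1, by simp, ?_⟩
      rw [hd, abs_of_nonpos (by linarith)]; ring
    · refine ⟨-1, by simp, ?_⟩
      rw [hd, abs_of_nonneg (by linarith)]; ring
  have hmem : ∀ u ∈ Icc 0 (dist x y), s + ε * u ∈ Icc α β := by
    intro u hu
    have h1 : ε = 1 ∨ ε = -1 := by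
      rcases abs_choice ε with h | h <;> rw [hε] at h
      · left; exact h.symm
      · right; linarith
    rcases h1 with rfl | rfl
    · constructor <;> linarith [hu.1, hu.2, hs.1, hs.2, ht.1, ht.2]
    · constructor <;> linarith [hu.1, hu.2, hs.1, hs.2, ht.1, ht.2]
  have hiso : ∀ u ∈ Icc 0 (dist x y), ∀ v ∈ Icc 0 (dist x y),
      dist (f (s + ε * u)) (f (s + ε * v)) = |u - v| := by
    intro u hu v hv
    rw [hf _ (hmem u hu) _ (hmem v hv)]
    have : s + ε * u - (s + ε * v) = ε * (u - v) := by ring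
    rw [this, abs_mul, hε, one_mul]
  have h0 : f (s + ε * 0) = x := by simpa using hsx
  have h1 : f (s + ε * dist x y) = y := by rw [hεt, hty]
  refine ⟨fun u => f (s + ε * u), h0, h1, hiso, ?_⟩
  obtain ⟨hc, hi⟩ := geod_cont (φ := fun u => f (s + ε * u)) hiso
  have := isArc_of_Icc hdpos _ hc hi
  rw [h0, h1] at this
  exact seg_eq_of_arc hT hxy this

lemma mid_of_mem_seg (hT : IsRTree T) {x y z : T} (h : z ∈ seg x y) : MidP x z y := by
  obtain ⟨φ, h0, h1, h2, h3⟩ := exists_geod hT x y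
  rw [h3] at h
  obtain ⟨t, ht, rfl⟩ := h
  have hd : (0:ℝ) ≤ dist x y := dist_nonneg
  have e1 := h2 0 ⟨le_refl _, hd⟩ t ht
  have e2 := h2 t ht (dist x y) ⟨hd, le_refl _⟩
  rw [h0, abs_of_nonpos (by linarith [ht.1])] at e1
  rw [h1, abs_of_nonpos (by linarith [ht.2])] at e2
  unfold MidP
  linarith

/-- Concatenation of segments. -/
lemma seg_concat (hT : IsRTree T) {x z y : T} (h : ∀ w, w ∈ seg x z → w ∈ seg z y → w = z) :
    z ∈ seg x y := by
  obtain ⟨φ, f0, f1, f2, f3⟩ := exists_geod hT x z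
  obtain ⟨ψ, g0, g1, g2, g3⟩ := exists_geod hT z y
  have hp : (0:ℝ) ≤ dist x z := dist_nonneg
  have hq : (0:ℝ) ≤ dist z y := dist_nonneg
  set p := dist x z with hpdef
  set q := dist z y with hqdef
  rcases eq_or_ne x y with hxy | hxy
  · subst hxy
    have hx1 : x ∈ seg x z := by rw [f3, ← f0]; exact mem_image_of_mem _ ⟨le_refl _, hp⟩
    have hx2 : x ∈ seg z x := by
      rw [g3]; exact ⟨q, ⟨hq, le_refl _⟩, g1⟩
    have := h x hx1 hx2
    subst this
    simp [seg]
  let k : ℝ → T := fun t => if t ≤ p then φ t else ψ (t - p)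
  have k1 : ∀ t, t ≤ p → k t = φ t := fun t ht => if_pos ht
  have k2 : ∀ t, p ≤ t → k t = ψ (t - p) := by
    intro t ht
    rcases eq_or_lt_of_le ht with h | h
    · subst h; simp [k, f1, g0]
    · exact if_neg (not_le.2 h)
  obtain ⟨fc, fi⟩ := geod_cont f2
  obtain ⟨gc, gi⟩ := geod_cont g2
  have hU : Icc 0 (p + q) = Icc 0 p ∪ Icc p (p + q) := by
    rw [Icc_union_Icc_eq_Icc hp (by linarith)]
  have kc : ContinuousOn k (Icc 0 (p + q)) := by
    rw [hU]
    apply ContinuousOn.union_of_isClosed _ _ isClosed_Icc isClosed_Icc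
    · exact fc.congr (fun t ht => k1 t ht.2)
    · have : ContinuousOn (fun t => ψ (t - p)) (Icc p (p + q)) :=
        gc.comp (by fun_prop) (fun t ht => ⟨by linarith [ht.1], by linarith [ht.2]⟩)
      exact this.congr (fun t ht => k2 t ht.1)
  have key : ∀ s ∈ Icc 0 p, ∀ t ∈ Icc p (p + q), k s = k t → s = t := by
    intro s hs t ht hst
    rw [k1 s hs.2, k2 t ht.1] at hst
    have ht' : t - p ∈ Icc 0 q := ⟨by linarith [ht.1], by linarith [ht.2]⟩
    have m1 : φ s ∈ seg x z := by rw [f3]; exact mem_image_of_mem _ hs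
    have m2 : φ s ∈ seg z y := by rw [g3, hst]; exact mem_image_of_mem _ ht'
    have e := h _ m1 m2
    have e1 : s = p := fi hs ⟨hp, le_refl _⟩ (by rw [e, f1])
    have e2 : t - p = 0 := gi ht' ⟨le_refl _, hq⟩ (by rw [← hst, e, g0])
    linarith
  have ki : InjOn k (Icc 0 (p + q)) := by
    intro s hs t ht hst
    rw [hU] at hs ht
    rcases hs with hs | hs <;> rcases ht with ht | ht
    · rw [k1 s hs.2, k1 t ht.2] at hst
      exact fi hs ht hst
    · exact key s hs t ht hst
    · exact (key t ht s hs hst.symm).symm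
    · rw [k2 s hs.1, k2 t ht.1] at hst
      have := gi (x₁ := s - p) (x₂ := t - p) ⟨by linarith [hs.1], by linarith [hs.2]⟩
        ⟨by linarith [ht.1], by linarith [ht.2]⟩ hst
      linarith
  have hpq : 0 < p + q := by
    have := dist_triangle x z y
    have := dist_pos.2 hxy
    linarith
  have harc := isArc_of_Icc hpq k kc ki
  rw [k1 0 hp, f0, k2 (p + q) (by linarith), show p + q - p = q by ring, g1] at harc
  rw [seg_eq_of_arc hT hxy harc]
  exact ⟨p, ⟨hp, by linarith⟩, by rw [k1 p le_rfl, f1]⟩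

lemma mem_seg_iff (hT : IsRTree T) {x y z : T} : z ∈ seg x y ↔ MidP x z y := by
  refine ⟨mid_of_mem_seg hT, fun h => seg_concat hT ?_⟩
  intro w h1 h2
  have h1 := mid_of_mem_seg hT h1
  have h2 := mid_of_mem_seg hT h2
  unfold MidP at *
  have t1 := dist_triangle x w y
  have e1 := dist_comm w z
  have : dist w z = 0 := by
    have := dist_nonneg (x := w) (y := z)
    linarith
  exact dist_eq_zero.1 this

lemma MidP.symm {x z y : T} (h : MidP x z y) : MidP y z x := by
  unfold MidP at *
  rw [dist_comm y z, dist_comm z x, dist_comm y x]; linarith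

lemma MidP.left (x y : T) : MidP x x y := by simp [MidP]
lemma MidP.right (x y : T) : MidP x y y := by simp [MidP]

lemma MidP.trans1 {x z y w : T} (h : MidP x z y) (h' : MidP x w z) : MidP x w y := by
  unfold MidP at *
  have := dist_triangle x w y
  have := dist_triangle w z y
  linarith

lemma MidP.trans2 {x z y w : T} (h : MidP x z y) (h' : MidP x w z) : MidP w z y := by
  unfold MidP at *
  have := dist_triangle x w y
  have := dist_triangle w z y
  linarith

lemma MidP.antisymm {x z w : T} (h : MidP x z w) (h' : MidP x w z) : z = w := by
  unfold MidP at *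
  have := dist_comm z w
  apply dist_eq_zero.1
  linarith

lemma MidP.comparable (hT : IsRTree T) {x y z w : T} (h : MidP x z y) (h' : MidP x w y) :
    MidP x z w ∨ MidP x w z := by
  obtain ⟨φ, h0, h1, h2, h3⟩ := exists_geod hT x y
  rw [← mem_seg_iff hT, h3] at h h'
  obtain ⟨s, hs, rfl⟩ := h
  obtain ⟨t, ht, rfl⟩ := h'
  have hd : (0:ℝ) ≤ dist x y := dist_nonneg
  have e1 := h2 0 ⟨le_refl _, hd⟩ s hs
  have e2 := h2 0 ⟨le_refl _, hd⟩ t ht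
  have e3 := h2 s hs t ht
  have e4 := h2 t ht s hs
  rw [h0, abs_of_nonpos (by linarith [hs.1])] at e1
  rw [h0, abs_of_nonpos (by linarith [ht.1])] at e2
  unfold MidP
  rcases le_total s t with h | h
  · left
    rw [abs_of_nonpos (by linarith)] at e3
    linarith
  · right
    rw [abs_of_nonpos (by linarith)] at e4
    linarith

lemma exists_mid_dist (hT : IsRTree T) {x y : T} {r : ℝ} (h0 : 0 ≤ r) (h1 : r ≤ dist x y) :
    ∃ c, MidP x c y ∧ dist x c = r := by
  obtain ⟨φ, f0, f1, f2, f3⟩ := exists_geod hT x y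
  refine ⟨φ r, ?_, ?_⟩
  · rw [← mem_seg_iff hT, f3]; exact ⟨r, ⟨h0, h1⟩, rfl⟩
  · have := f2 0 ⟨le_refl _, by linarith⟩ r ⟨h0, h1⟩
    rw [f0, abs_of_nonpos (by linarith)] at this
    linarith

lemma isCompact_seg (hT : IsRTree T) (x y : T) : IsCompact (seg x y) := by
  obtain ⟨φ, f0, f1, f2, f3⟩ := exists_geod hT x y
  rw [f3]
  exact isCompact_Icc.image_of_continuousOn (geod_cont f2).1

lemma exists_median (hT : IsRTree T) (x y z : T) :
    ∃ m, MidP x m y ∧ MidP x m z ∧ MidP y m z := by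
  have hK : IsCompact (seg x y ∩ seg x z) :=
    (isCompact_seg hT x y).inter_right (isCompact_seg hT x z).isClosed
  have hne : (seg x y ∩ seg x z).Nonempty :=
    ⟨x, (mem_seg_iff hT).2 (MidP.left _ _), (mem_seg_iff hT).2 (MidP.left _ _)⟩
  obtain ⟨m, ⟨hm1, hm2⟩, hmax⟩ := hK.exists_isMaxOn hne
    (f := fun w => dist x w) (by fun_prop)
  rw [mem_seg_iff hT] at hm1 hm2
  refine ⟨m, hm1, hm2, ?_⟩
  rw [← mem_seg_iff hT]
  apply seg_concat hT
  intro v hv1 hv2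
  rw [mem_seg_iff hT] at hv1 hv2
  have a1 : MidP x v y := (hm1.symm.trans1 hv1).symm
  have a2 : MidP x m v := (hm1.symm.trans2 hv1).symm
  have a3 : MidP x v z := (hm2.symm.trans1 hv2.symm).symm
  have := hmax ⟨(mem_seg_iff hT).2 a1, (mem_seg_iff hT).2 a3⟩
  simp only [mem_ofPred_eq] at this
  unfold MidP at a2
  have e := dist_nonneg (x := m) (y := v)
  exact (dist_eq_zero.1 (by linarith : dist m v = 0)).symm

lemma MidP.join (hT : IsRTree T) {x z y w : T} (h : MidP x z y) (h' : MidP z y w)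
    (hne : z ≠ y) : MidP x y w ∧ MidP x z w := by
  suffices hs : MidP x y w from ⟨hs, hs.trans1 h⟩
  obtain ⟨m, m1, m2, m3⟩ := exists_median hT x y w
  rcases MidP.comparable hT h.symm m1.symm with hc | hc
  · exfalso
    have := m3.trans1 hc
    exact hne (MidP.antisymm this.symm h'.symm)
  · have h2 : MidP m y w := h'.trans2 hc.symm
    have : m = y := (MidP.antisymm m3.symm h2.symm)
    rwa [this] at m2

end Tree

section Action
variable {T : Type*} [MetricSpace T] {G : Type*} [Group G] [MulAction G T]

lemma mid_smul (hT : IsRTree T) (hact : ActsByWeakHomeos G T) (g : G) {x z y : T}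
    (h : MidP x z y) : MidP (g • x) (g • z) (g • y) := by
  by_cases h1 : z = x
  · subst h1; exact MidP.left _ _
  by_cases h2 : z = y
  · subst h2; exact MidP.right _ _
  have := ((hact g).2 z x y).1 ⟨(mem_seg_iff hT).2 h, h1, h2⟩
  exact (mem_seg_iff hT).1 this.1

/-- Non-nesting at a fixed endpoint. -/
lemma nonnest_fix (hT : IsRTree T) (hact : ActsByWeakHomeos G T) (hnn : NonNesting G T)
    (g : G) {a y : T} (ha : g • a = a) (h : MidP a (g • y) y) : g • y = y := by
  by_contra hne
  apply hnn g a y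
  rw [ssubset_iff_subset_not_subset]
  have himg : ∀ w, w ∈ (fun t : T => g • t) '' seg a y → MidP a w (g • y) := by
    rintro w ⟨v, hv, rfl⟩
    have := mid_smul hT hact g ((mem_seg_iff hT).1 hv)
    rwa [ha] at this
  constructor
  · intro w hw
    exact (mem_seg_iff hT).2 (h.trans1 (himg w hw))
  · intro hsub
    have := himg y (hsub ((mem_seg_iff hT).2 (MidP.right _ _)))
    exact hne (MidP.antisymm h this)

lemma turn (hT : IsRTree T) (hact : ActsByWeakHomeos G T) (hnn : NonNesting G T)
    (g : G) {a x : T} (ha : g • a = a)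
    (hfix : ∀ y, g • y = y → MidP a y x → y = a) : MidP x a (g • x) := by
  obtain ⟨c, c1, c2, c3⟩ := exists_median hT a x (g • x)
  have ha' : g⁻¹ • a = a := by rw [inv_smul_eq_iff, ha]
  have d1 : MidP a (g⁻¹ • c) x := by
    have := mid_smul hT hact g⁻¹ c2
    rwa [ha', inv_smul_smul] at this
  have hc : g • c = c := by
    rcases MidP.comparable hT c1 d1 with h | h
    · have := nonnest_fix hT hact hnn g (y := g⁻¹ • c) ha (by rwa [smul_inv_smul])
      rw [smul_inv_smul] at this
      exact (inv_smul_eq_iff.1 this.symm).symm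
    · have := nonnest_fix hT hact hnn g⁻¹ ha' h
      rw [inv_smul_eq_iff] at this; exact this.symm
  rw [hfix c hc c1] at c3
  exact c3

lemma push (hT : IsRTree T) (hact : ActsByWeakHomeos G T) (g : G) {a b t : T}
    (ha : g • a = a) (hb : MidP b a (g • b)) (ht : ¬ MidP t a b) : MidP (g • t) a b := by
  obtain ⟨m, m1, m2, m3⟩ := exists_median hT a t b
  have hma : m ≠ a := by rintro rfl; exact ht m3
  have hgm : a ≠ g • m := by
    intro h
    apply hma
    have h2 : g • m = g • a := by rw [ha, ← h]
    exact smul_left_cancel g h2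
  have e1 := mid_smul hT hact g m1
  have e2 := mid_smul hT hact g m2
  rw [ha] at e1 e2
  have e3 : MidP b a (g • m) := (hb.symm.trans2 e2.symm).symm
  exact (MidP.join hT e3 e1 hgm).2.symm

/-- Archimedean property. -/
lemma arch (hT : IsRTree T) (hact : ActsByWeakHomeos G T) (f : G) {a b t : T}
    (hU : ∀ s, MidP b a s → MidP b a (f • s) ∧ MidP a (f • a) (f • s))
    (hfix : ∀ s : T, f • s ≠ s) : ∃ n : ℕ, ¬ MidP b a ((f⁻¹) ^ n • t) := by
  by_contra hcon
  push Not at hcon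
  have hseq : ∀ n : ℕ, ∀ s : T, (∀ k : ℕ, MidP b a ((f⁻¹) ^ k • s)) → MidP a (f ^ n • a) s := by
    intro n
    induction n with
    | zero => intro s _; simpa using MidP.left a s
    | succ n ih =>
      intro s hs
      have h1 := ih (f⁻¹ • s) (fun k => by
        have := hs (k + 1); rwa [pow_succ, mul_smul] at this)
      have h2 := mid_smul hT hact f h1
      rw [smul_inv_smul, ← mul_smul, ← pow_succ'] at h2
      have h3 := (hU (f⁻¹ • s) (by simpa using hs 1)).2
      rw [smul_inv_smul] at h3
      exact (h3.symm.trans1 h2.symm).symm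
  have hU2 : ∀ n : ℕ, MidP b a (f ^ n • a) := by
    intro n
    induction n with
    | zero => simpa using MidP.right b a
    | succ n ih => rw [pow_succ', mul_smul]; exact (hU _ ih).1
  have hin := fun n => hseq n t hcon
  have hstep : ∀ n : ℕ, MidP a (f • a) (f ^ (n + 1) • a) := by
    intro n; rw [pow_succ', mul_smul]; exact (hU _ (hU2 n)).2
  have hle : ∀ n : ℕ, dist a (f ^ n • a) ≤ dist a t := by
    intro n
    have := hin n
    unfold MidP at this
    linarith [dist_nonneg (x := f ^ n • a) (y := t)]
  have hbdd : BddAbove (range fun n : ℕ => dist a (f ^ n • a)) :=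
    ⟨dist a t, by rintro _ ⟨n, rfl⟩; exact hle n⟩
  have hσ0 : 0 ≤ ⨆ n : ℕ, dist a (f ^ n • a) := Real.iSup_nonneg (fun n => dist_nonneg)
  obtain ⟨c, c1, c2⟩ := exists_mid_dist hT hσ0 (ciSup_le hle)
  have hleast : ∀ x, MidP a x t → (∀ n : ℕ, MidP a (f ^ n • a) x) → MidP a c x := by
    intro x hx hn
    rcases MidP.comparable hT c1 hx with h | h
    · exact h
    · have h2 : dist a c ≤ dist a x := by
        rw [c2]
        apply ciSup_le
        intro n
        have := hn n
        unfold MidP at this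
        linarith [dist_nonneg (x := f ^ n • a) (y := x)]
      have h3 := h
      unfold MidP at h3
      have : x = c := dist_eq_zero.1 (by linarith [dist_nonneg (x := x) (y := c)])
      rw [this]; exact MidP.right _ _
  have hub : ∀ n : ℕ, MidP a (f ^ n • a) c := by
    intro n
    rcases MidP.comparable hT (hin n) c1 with h | h
    · exact h
    · have h2 : dist a (f ^ n • a) ≤ dist a c := by
        rw [c2]; exact le_ciSup hbdd n
      have h3 := h
      unfold MidP at h3
      have : c = f ^ n • a := dist_eq_zero.1 (by linarith [dist_nonneg (x := c) (y := f ^ n • a)])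
      rw [← this]; exact MidP.right _ _
  have hbt : MidP b a t := by simpa using hcon 0
  have hcU : MidP b a c := (hbt.symm.trans2 c1.symm).symm
  have hfc := (hU c hcU).2
  have hfn : ∀ n : ℕ, MidP a (f ^ n • a) (f • c) := by
    intro n
    cases n with
    | zero => simpa using MidP.left a (f • c)
    | succ n =>
      have := mid_smul hT hact f (hub n)
      rw [← mul_smul, ← pow_succ'] at this
      exact (hfc.symm.trans1 this.symm).symm
  have hcfc : MidP a c (f • c) := by
    obtain ⟨m, m1, m2, m3⟩ := exists_median hT a t (f • c)
    refine m2.trans1 (hleast m m1 ?_)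
    intro n
    -- the point lies on both segments, hence before the median
    rcases MidP.comparable hT (hin n) m1 with h | h
    · exact h
    · have k1 : MidP m (f ^ n • a) t := (hin n).trans2 h
      have k2 : MidP m (f ^ n • a) (f • c) := (hfn n).trans2 h
      have : m = f ^ n • a := by
        unfold MidP at m3 k1 k2
        have q1 := dist_triangle t (f ^ n • a) (f • c)
        have q2 := dist_comm t (f ^ n • a)
        have q3 := dist_comm t m
        exact dist_eq_zero.1 (by linarith [dist_nonneg (x := m) (y := f ^ n • a)])
      rw [← this]; exact MidP.right _ _
  have hfa : MidP a (f • a) c := by simpa using hub 1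
  have h1 : MidP (f • a) c (f • c) := hcfc.trans2 hfa
  have h2 : MidP a (f⁻¹ • c) c := by
    have := mid_smul hT hact f⁻¹ h1
    rw [inv_smul_smul, inv_smul_smul] at this
    exact this
  have h3 : MidP a c (f⁻¹ • c) := by
    apply hleast _ (c1.trans1 h2)
    intro n
    have h4 : MidP (f • a) (f ^ (n + 1) • a) c := (hub (n + 1)).trans2 (hstep n)
    have := mid_smul hT hact f⁻¹ h4
    rwa [inv_smul_smul, pow_succ', mul_smul, inv_smul_smul] at this
  have h5 := MidP.antisymm h2 h3
  rw [inv_smul_eq_iff] at h5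
  exact hfix c h5.symm

/-- The basic configuration. -/
structure Config (T : Type*) [MetricSpace T] {G : Type*} [Group G] [MulAction G T]
    (g h : G) (a b : T) : Prop where
  ga : g • a = a
  hb : h • b = b
  ne : a ≠ b
  t1 : MidP b a (g • b)
  t2 : MidP b a (g⁻¹ • b)
  t3 : MidP a b (h • a)
  t4 : MidP a b (h⁻¹ • a)
  b1 : ∀ x, g • x = x → MidP x a b
  b2 : ∀ y, h • y = y → MidP y b a

lemma Config.swap {g h : G} {a b : T} (c : Config T g h a b) : Config T h⁻¹ g⁻¹ b a where
  ga := by rw [inv_smul_eq_iff, c.hb]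
  hb := by rw [inv_smul_eq_iff, c.ga]
  ne := c.ne.symm
  t1 := c.t4
  t2 := by rw [inv_inv]; exact c.t3
  t3 := c.t2
  t4 := by rw [inv_inv]; exact c.t1
  b1 := fun x hx => c.b2 x (by rw [inv_smul_eq_iff] at hx; exact hx.symm)
  b2 := fun x hx => c.b1 x (by rw [inv_smul_eq_iff] at hx; exact hx.symm)

lemma not_both {a b t : T} (hne : a ≠ b) (h : MidP t b a) : ¬ MidP t a b :=
  fun h' => hne (MidP.antisymm h' h)

lemma Config.push1 (hT : IsRTree T) (hact : ActsByWeakHomeos G T) {g h : G} {a b : T}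
    (c : Config T g h a b) {t : T} (ht : ¬ MidP t b a) : MidP ((g * h) • t) a b := by
  rw [mul_smul]
  apply push hT hact g c.ga c.t1
  exact not_both c.ne (push hT hact h c.hb c.t3 ht)

lemma Config.inU (hT : IsRTree T) (hact : ActsByWeakHomeos G T) {g h : G} {a b : T}
    (c : Config T g h a b) : ∀ s, MidP b a s →
      MidP b a ((g * h) • s) ∧ MidP a ((g * h) • a) ((g * h) • s) := by
  intro s hs
  refine ⟨(c.push1 hT hact (not_both c.ne.symm hs.symm)).symm, ?_⟩
  have h1 := mid_smul hT hact (g * h) hs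
  have h2 := mid_smul hT hact g c.t3
  rw [c.ga] at h2
  have h3 : (g * h) • b = g • b := by rw [mul_smul, c.hb]
  rw [← h3, ← mul_smul] at h2
  exact (MidP.join hT h2 h1 (fun e => c.ne (smul_left_cancel _ e).symm)).1

lemma Config.nofix1 (hT : IsRTree T) (hact : ActsByWeakHomeos G T) (hnn : NonNesting G T)
    {g h : G} {a b : T} (c : Config T g h a b) {t : T} (ht : MidP b a t) :
    (g * h) • t ≠ t := by
  intro hfix
  have h1 := (c.inU hT hact t ht).2
  rw [hfix] at h1
  have h2 := nonnest_fix hT hact hnn (g * h) hfix h1.symm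
  have h3 := mid_smul hT hact g c.t3
  rw [c.ga, ← mul_smul g h, h2] at h3
  have h4 : a = g • b := MidP.antisymm (MidP.left _ _) h3
  exact c.ne (smul_left_cancel g (by rw [c.ga]; exact h4))

lemma Config.nofix (hT : IsRTree T) (hact : ActsByWeakHomeos G T) (hnn : NonNesting G T)
    {g h : G} {a b : T} (c : Config T g h a b) (t : T) : (g * h) • t ≠ t := by
  intro hfix
  by_cases h1 : MidP t b a
  · apply c.swap.nofix1 hT hact hnn h1.symm
    rw [← mul_inv_rev, inv_smul_eq_iff, hfix]
  · have := c.push1 hT hact h1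
    rw [hfix] at this
    exact c.nofix1 hT hact hnn this.symm hfix

lemma inv_image {f : G} {L : Set T} (hL : (fun t : T => f • t) '' L = L) :
    (fun t : T => f⁻¹ • t) '' L = L := by
  conv_lhs => rw [← hL]
  rw [image_image]; simp

lemma inv_mem {f : G} {L : Set T} (hL : (fun t : T => f • t) '' L = L) {t : T} (ht : t ∈ L) :
    f • t ∈ L := by
  rw [← hL]; exact mem_image_of_mem _ ht

lemma inv_pow_mem {f : G} {L : Set T} (hL : (fun t : T => f • t) '' L = L) {t : T} (ht : t ∈ L)
    (n : ℕ) : f ^ n • t ∈ L := by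
  induction n with
  | zero => simpa using ht
  | succ n ih => rw [pow_succ', mul_smul]; exact inv_mem hL ih

/-- An invariant nonempty set meets the far side of `b`. -/
lemma Config.meets (hT : IsRTree T) (hact : ActsByWeakHomeos G T) (hnn : NonNesting G T)
    {g h : G} {a b : T} (c : Config T g h a b) {L : Set T} (hne : L.Nonempty)
    (hL : (fun t : T => (g * h) • t) '' L = L) : ∃ s ∈ L, MidP s b a := by
  obtain ⟨t, ht⟩ := hne
  obtain ⟨n, hn⟩ := arch hT hact (g * h) (t := t) (c.inU hT hact) (c.nofix hT hact hnn)
  have hL' := inv_image hL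
  refine ⟨(g * h)⁻¹ • ((g * h)⁻¹ ^ n • t), inv_mem hL' (inv_pow_mem hL' ht n), ?_⟩
  have := c.swap.push1 hT hact (t := (g * h)⁻¹ ^ n • t) (fun hh => hn hh.symm)
  rwa [← mul_inv_rev] at this

lemma Config.unique (hT : IsRTree T)
    {g h : G} {a b : T} (c : Config T g h a b) {L : Set T} (hconv : ConvexSubtree L)
    (hnt : NoTripod L) (hL : (fun t : T => (g * h) • t) '' L = L) (hbL : b ∈ L)
    (hact : ActsByWeakHomeos G T) {p : T} (hp : g • p = p) (hpL : p ∈ L) : p = a := by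
  by_contra hpa
  have hgb : g • b ∈ L := by
    have := inv_mem hL hbL
    rwa [mul_smul, c.hb] at this
  apply hnt
  refine ⟨p, b, g • b, ?_, ?_⟩
  · rintro d ⟨⟨d1, d2⟩, d3⟩
    rw [mem_seg_iff hT] at d1 d2 d3
    have e1 : MidP p a b := c.b1 p hp
    have e2 : MidP p a (g • b) := by
      have := mid_smul hT hact g e1
      rwa [hp, c.ga] at this
    have hda : d = a := by
      have e3 := c.t1
      unfold MidP at *
      have := dist_triangle p a d
      have := dist_triangle b a d
      have := dist_triangle (g • b) a d
      have k1 := dist_comm p a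
      have k2 := dist_comm b a
      have k3 := dist_comm (g • b) a
      have k4 := dist_comm p d
      have k5 := dist_comm b d
      have k6 := dist_comm (g • b) d
      have k7 := dist_comm (g • b) p
      rcases MidP.comparable hT e1 d1 with q | q <;>
      rcases MidP.comparable hT e3 d2 with r | r <;>
      · unfold MidP at q r
        have k8 := dist_comm a d
        have := dist_nonneg (x := a) (y := d)
        exact dist_eq_zero.1 (by linarith)
    subst hda
    refine ⟨fun e => hpa e.symm, c.ne, fun e => c.ne ?_⟩
    exact smul_left_cancel g (by rw [c.ga]; exact e)
  · rintro w ((hw | hw) | hw)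
    · exact hconv _ hpL _ hbL hw
    · exact hconv _ hbL _ hgb hw
    · exact hconv _ hgb _ hpL hw

end Action

/-- For a non-nesting action by weak homeomorphisms on an `ℝ`-tree,
if `g, h` are elliptic with `T^g ∩ T^h = ∅`, then `g * h` is loxodromic, its axis
contains the bridge `[a, b]` between `T^g` and `T^h`, and each of `T^g ∩ L_{gh}`
and `T^h ∩ L_{gh}` consists of exactly one point. -/
theorem mul_loxodromic_of_disjoint_fixedSets
    {T : Type*} [MetricSpace T] (hT : IsRTree T)
    {G : Type*} [Group G] [MulAction G T]
    (hact : ActsByWeakHomeos G T) (hnn : NonNesting G T)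
    (g h : G) (hg : ∃ t : T, g • t = t) (hh : ∃ t : T, h • t = t)
    (hdisj : fixedSet T g ∩ fixedSet T h = ∅)
    (a b : T) (ha : a ∈ fixedSet T g) (hb : b ∈ fixedSet T h)
    (hbridge : ∀ x ∈ fixedSet T g, ∀ y ∈ fixedSet T h, seg a b ⊆ seg x y) :
    (¬ ∃ t : T, (g * h) • t = t) ∧
      ∀ L : Set T, IsAxis (g * h) L →
        seg a b ⊆ L ∧ (∃! p : T, p ∈ fixedSet T g ∩ L) ∧
          (∃! p : T, p ∈ fixedSet T h ∩ L) := by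
  have iff := @mem_seg_iff T _ hT
  have hne : a ≠ b := by
    rintro rfl
    have : a ∈ fixedSet T g ∩ fixedSet T h := ⟨ha, hb⟩
    rw [hdisj] at this; exact this
  have b1 : ∀ x, g • x = x → MidP x a b := fun x hx =>
    iff.1 (hbridge x hx b hb (iff.2 (MidP.left _ _)))
  have b2 : ∀ y, h • y = y → MidP y b a := fun y hy =>
    (iff.1 (hbridge a ha y hy (iff.2 (MidP.right _ _)))).symm
  have ha' : g⁻¹ • a = a := by rw [inv_smul_eq_iff]; exact ha.symm
  have hb' : h⁻¹ • b = b := by rw [inv_smul_eq_iff]; exact hb.symm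
  have f1 : ∀ y, g • y = y → MidP a y b → y = a := fun y hy hm =>
    MidP.antisymm hm.symm (b1 y hy).symm
  have f2 : ∀ y, h • y = y → MidP b y a → y = b := fun y hy hm =>
    MidP.antisymm hm.symm (b2 y hy).symm
  have c : Config T g h a b :=
    { ga := ha, hb := hb, ne := hne
      t1 := turn hT hact hnn g ha f1
      t2 := turn hT hact hnn g⁻¹ ha' (fun y hy => f1 y (inv_smul_eq_iff.1 hy).symm)
      t3 := turn hT hact hnn h hb f2
      t4 := turn hT hact hnn h⁻¹ hb' (fun y hy => f2 y (inv_smul_eq_iff.1 hy).symm)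
      b1 := b1, b2 := b2 }
  refine ⟨fun ⟨t, ht⟩ => c.nofix hT hact hnn t ht, ?_⟩
  rintro L ⟨⟨hconv, hnt, hmax⟩, hL⟩
  have hLne : L.Nonempty := by
    rw [nonempty_iff_ne_empty]
    rintro rfl
    have := hmax {a} ?_ ?_ (empty_subset _)
    · exact singleton_ne_empty a this
    · intro x hx y hy
      rw [mem_singleton_iff] at hx hy
      subst hx; subst hy
      simp [seg]
    · rintro ⟨x, y, z, htri, hsub⟩
      have hx : x = a := hsub (Or.inl (Or.inl (iff.2 (MidP.left _ _))))
      have hy : y = a := hsub (Or.inl (Or.inl (iff.2 (MidP.right _ _))))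
      have hz : z = a := hsub (Or.inr (iff.2 (MidP.left _ _)))
      subst hx; subst hy; subst hz
      exact (htri _ ⟨⟨iff.2 (MidP.left _ _), iff.2 (MidP.left _ _)⟩, iff.2 (MidP.left _ _)⟩).1 rfl
  have hL' : (fun t : T => (h⁻¹ * g⁻¹) • t) '' L = L := by
    rw [← mul_inv_rev]; exact inv_image hL
  obtain ⟨s, hs, hsb⟩ := c.meets hT hact hnn hLne hL
  obtain ⟨t, ht, hta⟩ := c.swap.meets hT hact hnn hLne hL'
  have hj := MidP.join hT hsb hta.symm hne.symm
  have haL : a ∈ L := hconv s hs t ht (iff.2 hj.1)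
  have hbL : b ∈ L := hconv s hs t ht (iff.2 hj.2)
  refine ⟨hconv a haL b hbL, ⟨a, ⟨ha, haL⟩, ?_⟩, ⟨b, ⟨hb, hbL⟩, ?_⟩⟩
  · rintro p ⟨hp, hpL⟩
    exact c.unique hT hconv hnt hL hbL hact hp hpL
  · rintro p ⟨hp, hpL⟩
    exact c.swap.unique hT hconv hnt hL' haL hact (inv_smul_eq_iff.2 (Eq.symm hp)) hpL
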